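/- Let (E,σ) be a difference field of characteristic zero and F a subfield with σ(F) = F. Inside E, let F = S₀ ⊆ S₁ ⊆ … ⊆ S_e = S be a tower in which each S_i = S_{i−1}(s_i) is a Σ*-extension of S_{i−1} (s_i transcendental over S_{i−1}, σ(s_i) − s_i a nonzero element of S_{i−1}, and const(S_i,σ) = const(S_{i−1},σ)). Let t ∈ E be transcendental over S with σ(t) = a·t for some nonzero a ∈ F, and suppose F(t) is a Π-extension of F, i.e. const(F(t),σ) = const(F,σ). Then S(t) is a Π-extension of S, i.e. const(S(t),σ) = const(S,σ). -/

import Mathlib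

/-- `F(t)`: the subfield of `E` generated by the subfield `F` and the element `t`. -/
def adj {E : Type*} [Field E] (F : Subfield E) (t : E) : Subfield E :=
  Subfield.closure ((F : Set E) ∪ {t})

/-- The set of constants of the subfield `F` with respect to the automorphism `σ`. -/
def constSet {E : Type*} [Field E] (σ : E ≃+* E) (F : Subfield E) : Set E :=
  {c : E | c ∈ F ∧ σ c = c}

open Polynomial

section

variable {E : Type*} [Field E]

lemma mem_adj_iff (K : Subfield E) (u x : E) :
    x ∈ adj K u ↔ ∃ p q : K[X], x = aeval u p / aeval u q := by
  rw [← IntermediateField.mem_adjoin_simple_iff, ← IntermediateField.mem_toSubfield,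
    IntermediateField.adjoin_toSubfield, adj]
  have : Set.range (algebraMap K E) = K := Subtype.range_coe
  rw [this]

lemma le_adj (K : Subfield E) (u : E) : K ≤ adj K u :=
  fun _ hx => Subfield.subset_closure (Or.inl hx)

lemma self_mem_adj (K : Subfield E) (u : E) : u ∈ adj K u :=
  Subfield.subset_closure (Or.inr rfl)

lemma map_mem_adj {σ : E ≃+* E} {K : Subfield E} (hK : ∀ x ∈ K, σ x ∈ K) {u : E}
    (hu : σ u ∈ adj K u) : ∀ x ∈ adj K u, σ x ∈ adj K u := by
  have h : adj K u ≤ (adj K u).comap (σ : E →+* E) := by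
    refine Subfield.closure_le.2 ?_
    rintro x (hx | rfl)
    · exact le_adj K u (hK x hx)
    · exact hu
  exact fun x hx => h hx

/-- The endomorphism of `K[X]` acting by `φ` on coefficients and sending `X` to `α X + β`. -/
noncomputable def affineTwist {K : Type*} [Field K] (φ : K →+* K) (α β : K) : K[X] →+* K[X] :=
  (compRingHom (C α * X + C β)).comp (mapRingHom φ)

lemma affineTwist_apply {K : Type*} [Field K] (φ : K →+* K) (α β : K) (p : K[X]) :
    affineTwist φ α β p = (p.map φ).comp (C α * X + C β) := rfl

lemma natDegree_affineTwist {K : Type*} [Field K] (φ : K →+* K) {α : K} (hα : α ≠ 0) (β : K)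
    (p : K[X]) : (affineTwist φ α β p).natDegree = p.natDegree := by
  rw [affineTwist_apply, natDegree_comp, natDegree_map, natDegree_linear hα, mul_one]

lemma leadingCoeff_affineTwist {K : Type*} [Field K] (φ : K →+* K) {α : K} (hα : α ≠ 0) (β : K)
    (p : K[X]) :
    (affineTwist φ α β p).leadingCoeff = φ p.leadingCoeff * α ^ p.natDegree := by
  rw [affineTwist_apply, leadingCoeff_comp (by rw [natDegree_linear hα]; exact one_ne_zero),
    leadingCoeff_map, leadingCoeff_linear hα, natDegree_map]

lemma coeff_affineTwist_zero {K : Type*} [Field K] (φ : K →+* K) (α : K) (p : K[X]) (n : ℕ) :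
    (affineTwist φ α 0 p).coeff n = φ (p.coeff n) * α ^ n := by
  rw [affineTwist_apply, C_0, add_zero, comp_C_mul_X_coeff, coeff_map]

lemma affineTwist_ne_zero {K : Type*} [Field K] (φ : K →+* K) {α : K} (hα : α ≠ 0) (β : K)
    {p : K[X]} (hp : p ≠ 0) : affineTwist φ α β p ≠ 0 := by
  rw [← leadingCoeff_ne_zero, leadingCoeff_affineTwist φ hα]
  exact mul_ne_zero ((map_ne_zero φ).2 (leadingCoeff_ne_zero.2 hp)) (pow_ne_zero _ hα)

lemma affineTwist_eq_C_mul_of_dvd {K : Type*} [Field K] (φ : K →+* K) {α : K} (hα : α ≠ 0)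
    (β : K) {p : K[X]} (hp : p ≠ 0) (h : p ∣ affineTwist φ α β p) :
    ∃ v : K, affineTwist φ α β p = C v * p := by
  obtain ⟨r, hr⟩ := h
  have hne := affineTwist_ne_zero φ hα β hp
  have hr0 : r ≠ 0 := by rintro rfl; exact hne (by rw [hr, mul_zero])
  have hd := natDegree_affineTwist φ hα β p
  rw [hr, natDegree_mul hp hr0] at hd
  refine ⟨r.coeff 0, ?_⟩
  rw [← eq_C_of_natDegree_eq_zero (by omega), hr, mul_comm]

/-- The restriction of an automorphism of `E` to a subfield that it maps into itself. -/
def restrictHom (σ : E ≃+* E) (K : Subfield E) (hK : ∀ x ∈ K, σ x ∈ K) : K →+* K :=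
  (σ : E →+* E).restrict K K hK

lemma coe_restrictHom (σ : E ≃+* E) (K : Subfield E) (hK : ∀ x ∈ K, σ x ∈ K) (x : K) :
    (restrictHom σ K hK x : E) = σ x := rfl

lemma aeval_affineTwist {σ : E ≃+* E} {K : Subfield E} (hK : ∀ x ∈ K, σ x ∈ K) {u : E}
    {α β : K} (hu : σ u = α * u + β) (p : K[X]) :
    aeval u (affineTwist (restrictHom σ K hK) α β p) = σ (aeval u p) := by
  have h1 : aeval u (C α * X + C β : K[X]) = σ u := by
    rw [hu, map_add, map_mul, aeval_C, aeval_C, aeval_X]; rfl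
  rw [affineTwist_apply, aeval_comp, h1, aeval_def, eval₂_map, aeval_def,
    ← RingEquiv.coe_toRingHom σ, hom_eval₂]
  rfl

/-- In a first-order affine difference field extension `K(u)`, an element `g` with
`σ g / g ∈ K` is a quotient of polynomials with the same property. -/
lemma exists_semiInvariant_fraction {σ : E ≃+* E} {K : Subfield E} (hK : ∀ x ∈ K, σ x ∈ K)
    {u : E} {α β : K} (hα : α ≠ 0) (hu : σ u = α * u + β) (htr : Transcendental K u)
    {g : E} (hg : g ∈ adj K u) (hg0 : g ≠ 0) {w : K} (hw : σ g = w * g) :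
    ∃ p q : K[X], p ≠ 0 ∧ q ≠ 0 ∧ g = aeval u p / aeval u q ∧
      (∃ v : K, affineTwist (restrictHom σ K hK) α β p = C v * p) ∧
      ∃ v : K, affineTwist (restrictHom σ K hK) α β q = C v * q := by
  classical
  have hinj : ∀ r : K[X], aeval u r = 0 → r = 0 := transcendental_iff.1 htr
  obtain ⟨p₀, q₀, h₀⟩ := (mem_adj_iff K u g).1 hg
  have hq₀ : q₀ ≠ 0 := by rintro rfl; exact hg0 (by simp [h₀])
  obtain ⟨p, hp⟩ := EuclideanDomain.gcd_dvd_left p₀ q₀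
  obtain ⟨q, hq⟩ := EuclideanDomain.gcd_dvd_right p₀ q₀
  have hd : EuclideanDomain.gcd p₀ q₀ ≠ 0 := by
    intro h; exact hq₀ (by rw [hq, h, zero_mul])
  have hcop : IsCoprime p q := by
    have hb := EuclideanDomain.gcd_eq_gcd_ab p₀ q₀
    refine ⟨EuclideanDomain.gcdA p₀ q₀, EuclideanDomain.gcdB p₀ q₀, mul_left_cancel₀ hd ?_⟩
    linear_combination (EuclideanDomain.gcdA p₀ q₀) * (-hp) +
      (EuclideanDomain.gcdB p₀ q₀) * (-hq) - hb
  have hgpq : g = aeval u p / aeval u q := by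
    rw [h₀]
    rw [congrArg (aeval u) hp, congrArg (aeval u) hq, map_mul, map_mul, mul_div_mul_left _ _ fun h => hd (hinj _ h)]
  have hp0 : p ≠ 0 := by rintro rfl; exact hg0 (by simp [hgpq])
  have hq0 : q ≠ 0 := by rintro rfl; exact hg0 (by simp [hgpq])
  set τ := affineTwist (restrictHom σ K hK) α β with hτ
  have hqu : aeval u q ≠ 0 := fun h => hq0 (hinj _ h)
  have hqu' : σ (aeval u q) ≠ 0 := (map_ne_zero σ).2 hqu
  have key : τ p * q = C w * τ q * p := by
    refine (transcendental_iff_injective.1 htr) ?_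
    rw [map_mul, map_mul, map_mul, hτ, aeval_affineTwist hK hu, aeval_affineTwist hK hu, aeval_C]
    have := hw
    rw [hgpq, map_div₀, div_eq_iff hqu'] at this
    rw [this]
    field_simp
    exact mul_comm _ _
  have hcop' : IsCoprime (τ p) (τ q) := hcop.map τ
  refine ⟨p, q, hp0, hq0, hgpq, affineTwist_eq_C_mul_of_dvd _ hα β hp0 ?_,
    affineTwist_eq_C_mul_of_dvd _ hα β hq0 ?_⟩
  · exact hcop.dvd_of_dvd_mul_right (key ▸ dvd_mul_left _ _)
  · have h : q ∣ C w * τ q * p := key ▸ dvd_mul_left _ _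
    have hw0 : w ≠ 0 := by
      rintro rfl
      exact hg0 ((map_eq_zero σ).1 (by simpa using hw))
    have h' := hcop.symm.dvd_of_dvd_mul_right h
    exact ((isUnit_C.2 hw0.isUnit).dvd_mul_left).1 h'

/-- In a Σ*-extension `K(u)` of `K`, any nonzero `g` with `σ g / g ∈ K` lies in `K`. -/
lemma mem_of_map_eq_mul_of_sigma {σ : E ≃+* E} {K : Subfield E} (hK : ∀ x ∈ K, σ x ∈ K)
    {u : E} (hu : σ u - u ∈ K) (htr : Transcendental K u)
    (hconst : constSet σ (adj K u) = constSet σ K)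
    {g : E} (hg : g ∈ adj K u) (hg0 : g ≠ 0) {w : E} (hwK : w ∈ K) (hw : σ g = w * g) :
    g ∈ K := by
  have hu' : σ u = ((1 : K) : E) * u + ((⟨_, hu⟩ : K) : E) := by simp
  obtain ⟨p, q, hp0, hq0, rfl, hp, hq⟩ :=
    exists_semiInvariant_fraction hK one_ne_zero hu' htr hg hg0 (w := ⟨w, hwK⟩) hw
  have aeval_mem : ∀ r : K[X], r ≠ 0 →
      (∃ v : K, affineTwist (restrictHom σ K hK) 1 ⟨_, hu⟩ r = C v * r) → aeval u r ∈ K := by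
    rintro r hr ⟨v, hv⟩
    have hl : (r.leadingCoeff : E) ≠ 0 := by simpa using hr
    have h1 : σ (r.leadingCoeff : E) = v * r.leadingCoeff := by
      have := leadingCoeff_affineTwist (restrictHom σ K hK) one_ne_zero ⟨_, hu⟩ r
      rw [hv, leadingCoeff_mul, leadingCoeff_C, one_pow, mul_one] at this
      rw [← coe_restrictHom σ K hK, ← this]; rfl
    have h2 : σ (aeval u r) = v * aeval u r := by
      rw [← aeval_affineTwist hK hu', hv, map_mul, aeval_C]; rfl
    have hv0 : (v : E) ≠ 0 := by
      intro h
      rw [h, zero_mul] at h1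
      exact hl ((map_eq_zero σ).1 h1)
    have h3 : aeval u r / r.leadingCoeff ∈ constSet σ (adj K u) := by
      refine ⟨?_, ?_⟩
      · exact (mem_adj_iff K u _).2 ⟨r, C r.leadingCoeff, by rw [aeval_C]; rfl⟩
      · rw [map_div₀, h1, h2, mul_div_mul_left _ _ hv0]
    rw [hconst] at h3
    have := K.mul_mem h3.1 r.leadingCoeff.2
    rwa [div_mul_cancel₀ _ hl] at this
  exact K.div_mem (aeval_mem p hp0 hp) (aeval_mem q hq0 hq)

/-- A new constant in `K(u)` with `σ u = α u` forces a nonzero `g ∈ K` such that `σ g` is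
`g` times a nontrivial power of `α`. -/
lemma exists_map_mul_pow_eq_of_new_const {σ : E ≃+* E} {K : Subfield E}
    (hK : ∀ x ∈ K, σ x ∈ K) {u α : E} (hαK : α ∈ K) (hα : α ≠ 0) (hu : σ u = α * u)
    (htr : Transcendental K u) {c : E} (hc : c ∈ constSet σ (adj K u)) (hcK : c ∉ K) :
    ∃ g ∈ K, g ≠ 0 ∧ ∃ i j : ℕ, i ≠ j ∧ σ g * α ^ i = g * α ^ j := by
  have hinj : ∀ r : K[X], aeval u r = 0 → r = 0 := transcendental_iff.1 htr
  have hu' : σ u = ((⟨α, hαK⟩ : K) : E) * u + ((0 : K) : E) := by simp [hu]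
  have hα' : (⟨α, hαK⟩ : K) ≠ 0 := fun h => hα (congrArg Subtype.val h)
  have hc0 : c ≠ 0 := by rintro rfl; exact hcK K.zero_mem
  obtain ⟨p, q, hp0, hq0, rfl, ⟨v, hv⟩, ⟨v', hv'⟩⟩ :=
    exists_semiInvariant_fraction hK hα' hu' htr hc.1 hc0 (w := 1) (by simpa using hc.2)
  have hpu : aeval u p ≠ 0 := fun h => hp0 (hinj _ h)
  have hqu : aeval u q ≠ 0 := fun h => hq0 (hinj _ h)
  have eval_eq : ∀ (r : K[X]) (v : K),
      affineTwist (restrictHom σ K hK) ⟨α, hαK⟩ 0 r = C v * r →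
      σ (aeval u r) = v * aeval u r := by
    intro r v h
    rw [← aeval_affineTwist hK hu', h, map_mul, aeval_C]; rfl
  have coeff_eq : ∀ (r : K[X]) (v : K),
      affineTwist (restrictHom σ K hK) ⟨α, hαK⟩ 0 r = C v * r →
      ∀ n, σ (r.coeff n : E) * α ^ n = v * r.coeff n := by
    intro r v h n
    have := congrArg (fun r => ((r.coeff n : K) : E)) h
    simp only [coeff_affineTwist_zero, coeff_C_mul] at this
    exact this
  have hvv : (v : E) = v' := by
    have h := hc.2
    rw [map_div₀, eval_eq p v hv, eval_eq q v' hv', div_eq_div_iff _ hqu] at h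
    · exact mul_right_cancel₀ (mul_ne_zero hpu hqu) (by linear_combination h)
    · rw [← eval_eq q v' hv']; exact (map_ne_zero σ).2 hqu
  by_contra! hno
  have same : ∀ i j, p.coeff i ≠ 0 → q.coeff j ≠ 0 → i = j := by
    intro i j hi hj
    by_contra hij
    have hi' : (p.coeff i : E) ≠ 0 := by simpa using hi
    have hj' : (q.coeff j : E) ≠ 0 := by simpa using hj
    have hσj : σ (q.coeff j : E) ≠ 0 := (map_ne_zero σ).2 hj'
    have e1 := coeff_eq p v hv i
    have e2 := coeff_eq q v' hv' j
    refine hno _ (K.div_mem (p.coeff i).2 (q.coeff j).2) (div_ne_zero hi' hj') i j hij ?_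
    rw [map_div₀, div_mul_eq_mul_div, div_mul_eq_mul_div, div_eq_div_iff hσj hj', e1, hvv]
    linear_combination (-(p.coeff i : E)) * e2
  have hpl := leadingCoeff_ne_zero.2 hp0
  have hql := leadingCoeff_ne_zero.2 hq0
  have hpm : p = C p.leadingCoeff * X ^ q.natDegree := by
    have hdeg := same _ _ hpl hql
    ext n
    rw [coeff_C_mul, coeff_X_pow]
    split_ifs with h
    · rw [h, ← hdeg, mul_one]; rfl
    · by_contra hn
      exact h (same n _ (by simpa using hn) hql)
  have hqm : q = C q.leadingCoeff * X ^ q.natDegree := by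
    have hdeg := same _ _ hpl hql
    ext n
    rw [coeff_C_mul, coeff_X_pow]
    split_ifs with h
    · rw [h, mul_one]; rfl
    · by_contra hn
      exact h ((same _ n hpl (by simpa using hn)).symm.trans hdeg)
  have hu0 : u ≠ 0 := by
    rintro rfl
    exact X_ne_zero (hinj X (aeval_X _))
  apply hcK
  rw [hpm]
  nth_rw 2 [hqm]
  rw [map_mul, map_mul, map_pow, aeval_X, mul_div_mul_right _ _ (pow_ne_zero _ hu0), aeval_C,
    aeval_C]
  exact K.div_mem p.leadingCoeff.2 q.leadingCoeff.2

end

/-- If `S` is obtained from `F` by a tower of Σ*-extensions, `t` is transcendental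
over `S` with `σ(t) = a·t` for some `0 ≠ a ∈ F`, and `F(t)` is a Π-extension of `F`,
then `S(t)` is a Π-extension of `S`. -/
theorem pi_ext_over_sigma_tower {E : Type*} [Field E] [CharZero E] (σ : E ≃+* E)
    (F : Subfield E) (hF : F.map (σ : E →+* E) = F)
    (e : ℕ) (S : ℕ → Subfield E) (s : ℕ → E)
    (hS0 : S 0 = F)
    (hstep : ∀ i < e, S (i + 1) = adj (S i) (s i) ∧
      Transcendental (S i) (s i) ∧
      σ (s i) - s i ∈ S i ∧ σ (s i) - s i ≠ 0 ∧
      constSet σ (S (i + 1)) = constSet σ (S i))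
    (t a : E) (haF : a ∈ F) (ha0 : a ≠ 0)
    (htrans : Transcendental (S e) t) (hσt : σ t = a * t)
    (hPi : constSet σ (adj F t) = constSet σ F) :
    constSet σ (adj (S e) t) = constSet σ (S e) := by
  have hσF : ∀ x ∈ F, σ x ∈ F := fun x hx => by
    rw [← hF]; exact ⟨x, hx, rfl⟩
  have hσS : ∀ i ≤ e, ∀ x ∈ S i, σ x ∈ S i := by
    intro i
    induction i with
    | zero => intro _; rwa [hS0]
    | succ i ih =>
      intro hi
      obtain ⟨hadj, -, hs, -⟩ := hstep i hi
      rw [hadj]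
      refine map_mem_adj (ih (by omega)) ?_
      have := (adj (S i) (s i)).add_mem (le_adj _ _ hs) (self_mem_adj _ _)
      rwa [sub_add_cancel] at this
  have hFS : ∀ i ≤ e, F ≤ S i := by
    intro i
    induction i with
    | zero => intro _; rw [hS0]
    | succ i ih =>
      intro hi
      rw [(hstep i hi).1]
      exact (ih (by omega)).trans (le_adj _ _)
  have descend : ∀ i ≤ e, ∀ g ∈ S i, g ≠ 0 → ∀ w ∈ F, σ g = w * g → g ∈ F := by
    intro i
    induction i with
    | zero => intro _ g hg _ _ _ _; rwa [hS0] at hg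
    | succ i ih =>
      intro hi g hg hg0 w hw hgw
      obtain ⟨hadj, htr, hs, -, hc⟩ := hstep i hi
      rw [hadj] at hg hc
      exact ih (by omega) g (mem_of_map_eq_mul_of_sigma (hσS i (by omega)) hs htr hc hg hg0
        (hFS i (by omega) hw) hgw) hg0 w hw hgw
  have hFe := hFS e le_rfl
  refine Set.Subset.antisymm (fun c hc => ⟨?_, hc.2⟩) fun c hc => ⟨le_adj _ _ hc.1, hc.2⟩
  by_contra hcS
  obtain ⟨g, hgS, hg0, i, j, hij, hg⟩ := exists_map_mul_pow_eq_of_new_const (hσS e le_rfl)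
    (hFe haF) ha0 hσt htrans hc hcS
  have hgF : g ∈ F := by
    refine descend e le_rfl g hgS hg0 _ (F.div_mem (F.pow_mem haF j) (F.pow_mem haF i)) ?_
    rw [div_mul_eq_mul_div, eq_div_iff (pow_ne_zero _ ha0), hg, mul_comm]
  have ht0 : t ≠ 0 := by
    rintro rfl
    exact htrans (isAlgebraic_zero)
  have hyF : g * t ^ i / t ^ j ∈ F := by
    have h : g * t ^ i / t ^ j ∈ constSet σ (adj F t) := by
      have htm := self_mem_adj F t
      refine ⟨Subfield.div_mem _ (Subfield.mul_mem _ (le_adj _ _ hgF) (Subfield.pow_mem _ htm _))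
        (Subfield.pow_mem _ htm _), ?_⟩
      rw [map_div₀, map_mul, map_pow, map_pow, hσt, mul_pow, mul_pow, ← mul_assoc, hg,
        mul_right_comm, mul_comm (a ^ j) (t ^ j), mul_div_mul_right _ _ (pow_ne_zero _ ha0)]
    rw [hPi] at h
    exact h.1
  refine htrans ⟨C ⟨g, hgS⟩ * X ^ i - C ⟨_, hFe hyF⟩ * X ^ j, fun h => ?_, ?_⟩
  · have := congrArg (fun r => ((r.coeff i : S e) : E)) h
    simp [coeff_X_pow, hij] at this
    exact hg0 this
  · have h1 : aeval t (C ⟨g, hgS⟩ * X ^ i - C ⟨_, hFe hyF⟩ * X ^ j : (S e)[X]) =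
        g * t ^ i - g * t ^ i / t ^ j * t ^ j := by
      rw [map_sub, map_mul, map_mul, map_pow, map_pow, aeval_X, aeval_C, aeval_C]; rfl
    rw [h1, div_mul_cancel₀ _ (pow_ne_zero _ ht0), sub_self]
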